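/- arXiv:math/0609034 — 6 statements merged into one kernel-verified Lean document; each statement's English description precedes it below -/
import Mathlib

section
/- Lemma (order of the fake quantum dimension, sl(m|n) case): Let c = (c_1,…,c_{m+n−2}) ∈ ℕ^{m+n−2} and a ∈ ℂ be such that the weight λ = λ_a^c is typical. Then the product Π_{α∈Δ₁⁺} {⟨λ+ρ,α⟩} · Π_{α∈Δ₀⁺} {⟨ρ,α⟩} is a nonzero element of ℂ[[h]], and there exists a power series g ∈ ℂ[[h]] such that h^{mn} · Π_{α∈Δ₀⁺} {⟨λ+ρ,α⟩} = g · Π_{α∈Δ₁⁺} {⟨λ+ρ,α⟩} · Π_{α∈Δ₀⁺} {⟨ρ,α⟩}. (That is, the fake quantum dimension d(λ) = φ_{λ+ρ}(L'₀)/(φ_{λ+ρ}(L'₁)·φ_ρ(L'₀)) lies in h^{−k}ℂ[[h]] where k = |Δ₁⁺| = mn.) -/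
/-!
Lemma (order of the fake quantum dimension, sl(m|n) case).
-/

open scoped BigOperators

noncomputable section

namespace SLmn

/-- The weight space `V = ℂ^{m+n}`, with coordinates `ε_1,…,ε_m,δ_1,…,δ_n`. -/
abbrev V (m n : ℕ) := Fin (m + n) → ℂ

variable (m n : ℕ)

/-- The basis vector `ε_i` (here `i : Fin m` is the 0-based index). -/
def eps (i : Fin m) : V m n := Pi.single (Fin.castAdd n i) 1

/-- The basis vector `δ_j`. -/
def delta (j : Fin n) : V m n := Pi.single (Fin.natAdd m j) 1

/-- The symmetric bilinear form with `⟨ε_i,ε_j⟩ = δ_{ij}`, `⟨δ_i,δ_j⟩ = -δ_{ij}`,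
`⟨ε_i,δ_j⟩ = 0`. -/
def form (x y : V m n) : ℂ :=
  (∑ i : Fin m, x (Fin.castAdd n i) * y (Fin.castAdd n i)) -
    ∑ j : Fin n, x (Fin.natAdd m j) * y (Fin.natAdd m j)

/-- `ρ₀ = ½(Σ_i (m+1-2i)ε_i + Σ_j (n+1-2j)δ_j)` (1-based indices). -/
def rho0 : V m n :=
  (1 / 2 : ℂ) •
    ((∑ i : Fin m, ((m : ℂ) + 1 - 2 * ((i : ℕ) + 1)) • eps m n i) +
      ∑ j : Fin n, ((n : ℂ) + 1 - 2 * ((j : ℕ) + 1)) • delta m n j)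

/-- `ρ₁ = ½(n Σ_i ε_i - m Σ_j δ_j)`. -/
def rho1 : V m n :=
  (1 / 2 : ℂ) • ((n : ℂ) • ∑ i : Fin m, eps m n i - (m : ℂ) • ∑ j : Fin n, delta m n j)

/-- `ρ = ρ₀ - ρ₁`. -/
def rho : V m n := rho0 m n - rho1 m n

/-- The fundamental weight `w_k` (1-based `k`): `w_k = ε_1 + ⋯ + ε_k` for `1 ≤ k ≤ m`,
and `w_{m+k} = -(δ_{k+1} + ⋯ + δ_n)` for `1 ≤ k ≤ n-1`. -/
def w (k : ℕ) : V m n :=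
  if k ≤ m then ∑ i ∈ Finset.univ.filter fun i : Fin m => (i : ℕ) < k, eps m n i
  else -∑ j ∈ Finset.univ.filter fun j : Fin n => k - m ≤ (j : ℕ), delta m n j

/-- The index of the fundamental weight attached to the `k`-th entry (0-based) of
`c = (c_1,…,c_{m+n-2})`: `c_1,…,c_{m-1}` go with `w_1,…,w_{m-1}` and
`c_m,…,c_{m+n-2}` go with `w_{m+1},…,w_{m+n-1}`. -/
def wIdx (m k : ℕ) : ℕ := if k + 1 < m then k + 1 else k + 2

/-- The weight `λ_a^c = c_1 w_1 + ⋯ + c_{m-1} w_{m-1} + a·w_m + c_m w_{m+1} + ⋯ +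
c_{m+n-2} w_{m+n-1}`. -/
def lam (c : Fin (m + n - 2) → ℕ) (a : ℂ) : V m n :=
  a • w m n m + ∑ k : Fin (m + n - 2), (c k : ℂ) • w m n (wIdx m k)

/-- `λ` is typical if `⟨λ+ρ,α⟩ ≠ 0` for every odd positive root `α = ε_i - δ_j`. -/
def Typical (x : V m n) : Prop :=
  ∀ (i : Fin m) (j : Fin n), form m n (x + rho m n) (eps m n i - delta m n j) ≠ 0

/-- `exp(z h) ∈ ℂ[[h]]`. -/
def exph (z : ℂ) : PowerSeries ℂ := PowerSeries.mk fun j => z ^ j / (j.factorial : ℂ)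

/-- `q^z := exp(zh/2)`. -/
def qpow (z : ℂ) : PowerSeries ℂ := exph (z / 2)

/-- `{z} := q^z - q^{-z}`. -/
def brace (z : ℂ) : PowerSeries ℂ := qpow z - qpow (-z)

/-- `Π_{α ∈ Δ₀⁺} {⟨x,α⟩}` where `Δ₀⁺ = {ε_i-ε_j}_{i<j} ∪ {δ_i-δ_j}_{i<j}`. -/
def evenProd (x : V m n) : PowerSeries ℂ :=
  (∏ p ∈ Finset.univ.filter fun p : Fin m × Fin m => p.1 < p.2,
      brace (form m n x (eps m n p.1 - eps m n p.2))) *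
    ∏ p ∈ Finset.univ.filter fun p : Fin n × Fin n => p.1 < p.2,
      brace (form m n x (delta m n p.1 - delta m n p.2))

/-- `Π_{α ∈ Δ₁⁺} {⟨x,α⟩}` where `Δ₁⁺ = {ε_i - δ_j}`. -/
def oddProd (x : V m n) : PowerSeries ℂ :=
  ∏ p : Fin m × Fin n, brace (form m n x (eps m n p.1 - delta m n p.2))

theorem form_eps_sub_eps (x : V m n) (i j : Fin m) :
    form m n x (eps m n i - eps m n j) = x (Fin.castAdd n i) - x (Fin.castAdd n j) := by
  simp [form, eps, mul_sub, Pi.single_apply, Fin.ext_iff, Finset.sum_sub_distrib]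
  simp [← Fin.ext_iff]
  have h (a : Fin n) (i : Fin m) : m + (a : ℕ) ≠ i := by omega
  simp [h]

theorem form_delta_sub_delta (x : V m n) (i j : Fin n) :
    form m n x (delta m n i - delta m n j) = x (Fin.natAdd m j) - x (Fin.natAdd m i) := by
  simp [form, delta, mul_sub, Pi.single_apply, Fin.ext_iff, Finset.sum_sub_distrib]
  simp [← Fin.ext_iff]
  have h (a : Fin n) (i : Fin m) : (i : ℕ) ≠ m + a := by omega
  simp [h]

theorem rho_castAdd (i : Fin m) :
    rho m n (Fin.castAdd n i) = ((m : ℂ) - n - 1) / 2 - (i : ℕ) := by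
  have h (a : Fin n) : (i : ℕ) ≠ m + a := by omega
  simp [rho, rho0, rho1, eps, delta, Pi.single_apply, Fin.ext_iff, h]
  simp [← Fin.ext_iff, Finset.filter_eq]
  ring

theorem rho_natAdd (j : Fin n) :
    rho m n (Fin.natAdd m j) = ((n : ℂ) + m - 1) / 2 - (j : ℕ) := by
  have h (a : Fin m) : m + (j : ℕ) ≠ a := by omega
  simp [rho, rho0, rho1, eps, delta, Pi.single_apply, Fin.ext_iff, h]
  simp [← Fin.ext_iff, Finset.filter_eq]
  ring

theorem X_dvd_brace (z : ℂ) : PowerSeries.X ∣ brace z := by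
  rw [PowerSeries.X_dvd_iff, ← PowerSeries.coeff_zero_eq_constantCoeff_apply, brace, map_sub]
  simp only [qpow, exph, PowerSeries.coeff_mk, pow_zero, sub_self]

theorem associated_brace {z : ℂ} (hz : z ≠ 0) : Associated PowerSeries.X (brace z) := by
  obtain ⟨u, hu⟩ := X_dvd_brace z
  have hc : PowerSeries.coeff 1 (brace z) = z := by
    simp [brace, qpow, exph]
    ring
  have hunit : IsUnit u := by
    rw [PowerSeries.isUnit_iff_constantCoeff, isUnit_iff_ne_zero]
    rw [hu, show (1 : ℕ) = 0 + 1 from rfl, PowerSeries.coeff_succ_X_mul,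
      PowerSeries.coeff_zero_eq_constantCoeff_apply] at hc
    exact hc ▸ hz
  exact ⟨hunit.unit, hu.symm⟩

theorem X_pow_card_dvd_prod_brace {ι : Type*} (s : Finset ι) (f : ι → ℂ) :
    PowerSeries.X ^ s.card ∣ ∏ i ∈ s, brace (f i) := by
  rw [← Finset.prod_const]
  exact Finset.prod_dvd_prod_of_dvd _ _ fun i _ => X_dvd_brace (f i)

theorem associated_prod_brace {ι : Type*} (s : Finset ι) (f : ι → ℂ) (hf : ∀ i ∈ s, f i ≠ 0) :
    Associated (PowerSeries.X ^ s.card) (∏ i ∈ s, brace (f i)) := by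
  rw [← Finset.prod_const]
  exact Associated.prod s _ _ fun i hi => associated_brace (hf i hi)

/-- The number of even positive roots. -/
def evenCard : ℕ :=
  (Finset.univ.filter fun p : Fin m × Fin m => p.1 < p.2).card +
    (Finset.univ.filter fun p : Fin n × Fin n => p.1 < p.2).card

theorem X_pow_dvd_evenProd (x : V m n) : PowerSeries.X ^ evenCard m n ∣ evenProd m n x := by
  rw [evenCard, pow_add]
  exact mul_dvd_mul (X_pow_card_dvd_prod_brace _ _) (X_pow_card_dvd_prod_brace _ _)

theorem associated_evenProd_rho :
    Associated (PowerSeries.X ^ evenCard m n) (evenProd m n (rho m n)) := by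
  rw [evenCard, pow_add]
  refine .mul_mul (associated_prod_brace _ _ ?_) (associated_prod_brace _ _ ?_)
  · rintro ⟨i, j⟩ hij
    replace hij : i < j := by simpa using hij
    simp [form_eps_sub_eps, rho_castAdd, sub_eq_zero, Fin.val_inj, hij.ne']
  · rintro ⟨i, j⟩ hij
    replace hij : i < j := by simpa using hij
    simp [form_delta_sub_delta, rho_natAdd, sub_eq_zero, Fin.val_inj, hij.ne]

theorem associated_oddProd {x : V m n} (hx : Typical m n x) :
    Associated (PowerSeries.X ^ (m * n)) (oddProd m n (x + rho m n)) := by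
  simpa [oddProd] using associated_prod_brace Finset.univ
    (fun p : Fin m × Fin n => form m n (x + rho m n) (eps m n p.1 - delta m n p.2))
    fun p _ => hx p.1 p.2

/-- Lemma (order of the fake quantum dimension, sl(m|n) case): if `λ = λ_a^c` is
typical, then `Π_{α∈Δ₁⁺} {⟨λ+ρ,α⟩} · Π_{α∈Δ₀⁺} {⟨ρ,α⟩}` is nonzero in `ℂ[[h]]`, and
`h^{mn} · Π_{α∈Δ₀⁺} {⟨λ+ρ,α⟩} = g · Π_{α∈Δ₁⁺} {⟨λ+ρ,α⟩} · Π_{α∈Δ₀⁺} {⟨ρ,α⟩}` for some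
`g ∈ ℂ[[h]]`; that is, `d(λ)` lies in `h^{-mn}ℂ[[h]]`. -/
theorem fake_dimension_order (hm : 1 ≤ m) (hn : 1 ≤ n) (hmn : m ≠ n)
    (c : Fin (m + n - 2) → ℕ) (a : ℂ) (hty : Typical m n (lam m n c a)) :
    oddProd m n (lam m n c a + rho m n) * evenProd m n (rho m n) ≠ 0 ∧
      ∃ g : PowerSeries ℂ,
        (PowerSeries.X : PowerSeries ℂ) ^ (m * n) * evenProd m n (lam m n c a + rho m n) =
          g * (oddProd m n (lam m n c a + rho m n) * evenProd m n (rho m n)) := by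
  have h := (associated_oddProd m n hty).mul_mul (associated_evenProd_rho m n)
  refine ⟨h.ne_zero_iff.mp (by simp), ?_⟩
  obtain ⟨g, hg⟩ := h.symm.dvd.trans
    (mul_dvd_mul_left _ (X_pow_dvd_evenProd m n (lam m n c a + rho m n)))
  exact ⟨g, by rw [hg, mul_comm]⟩

end SLmn
end
end

section
/- Lemma (order of the fake quantum dimension, osp(2|2n) case): Let c = (c_1,…,c_n) ∈ ℕ^n and a ∈ ℂ be such that the weight λ = λ_a^c is typical. Then the product Π_{α∈Δ₁⁺} {⟨λ+ρ,α⟩} · Π_{α∈Δ₀⁺} {⟨ρ,α⟩} is a nonzero element of ℂ[[h]], and there exists a power series g ∈ ℂ[[h]] such that h^{2n} · Π_{α∈Δ₀⁺} {⟨λ+ρ,α⟩} = g · Π_{α∈Δ₁⁺} {⟨λ+ρ,α⟩} · Π_{α∈Δ₀⁺} {⟨ρ,α⟩}. (That is, d(λ) lies in h^{−k}ℂ[[h]] with k = |Δ₁⁺| = 2n.) -/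
/-!
Lemma (order of the fake quantum dimension, osp(2|2n) case).
-/

open scoped BigOperators

noncomputable section

namespace Osp

/-- The weight space `V = ℂ^{1+n}`, with coordinates `ε, δ_1,…,δ_n`. -/
abbrev V (n : ℕ) := Fin (n + 1) → ℂ

variable (n : ℕ)

/-- The basis vector `ε`. -/
def eps : V n := Pi.single 0 1

/-- The basis vector `δ_j`. -/
def delta (j : Fin n) : V n := Pi.single j.succ 1

/-- The symmetric bilinear form with `⟨ε,ε⟩ = 1`, `⟨δ_i,δ_j⟩ = -δ_{ij}`, `⟨ε,δ_i⟩ = 0`. -/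
def form (x y : V n) : ℂ := x 0 * y 0 - ∑ j : Fin n, x j.succ * y j.succ

/-- `ρ₀ = Σ_i (n+1-i)δ_i` (1-based index `i`). -/
def rho0 : V n := ∑ j : Fin n, ((n : ℂ) + 1 - ((j : ℕ) + 1)) • delta n j

/-- `ρ₁ = n·ε`. -/
def rho1 : V n := (n : ℂ) • eps n

/-- `ρ = ρ₀ - ρ₁`. -/
def rho : V n := rho0 n - rho1 n

/-- The fundamental weight `w_{k+1} = ε + δ_1 + ⋯ + δ_k` for `0 ≤ k ≤ n`
(so `w 0 = w_1 = ε`). -/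
def w (k : ℕ) : V n :=
  eps n + ∑ j ∈ Finset.univ.filter fun j : Fin n => (j : ℕ) < k, delta n j

/-- The weight `λ_a^c = a·w_1 + c_1 w_2 + ⋯ + c_n w_{n+1}`. -/
def lam (c : Fin n → ℕ) (a : ℂ) : V n :=
  a • w n 0 + ∑ k : Fin n, (c k : ℂ) • w n ((k : ℕ) + 1)

/-- `λ` is typical if `⟨λ+ρ,α⟩ ≠ 0` for every odd positive root `α = ε ∓ δ_i`. -/
def Typical (x : V n) : Prop :=
  ∀ i : Fin n,
    form n (x + rho n) (eps n - delta n i) ≠ 0 ∧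
      form n (x + rho n) (eps n + delta n i) ≠ 0

/-- `exp(z h) ∈ ℂ[[h]]`. -/
def exph (z : ℂ) : PowerSeries ℂ := PowerSeries.mk fun j => z ^ j / (j.factorial : ℂ)

/-- `q^z := exp(zh/2)`. -/
def qpow (z : ℂ) : PowerSeries ℂ := exph (z / 2)

/-- `{z} := q^z - q^{-z}`. -/
def brace (z : ℂ) : PowerSeries ℂ := qpow z - qpow (-z)

/-- `Π_{α ∈ Δ₀⁺} {⟨x,α⟩}` where
`Δ₀⁺ = {δ_i-δ_j}_{i<j} ∪ {δ_i+δ_j}_{i<j} ∪ {2δ_i}`. -/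
def evenProd (x : V n) : PowerSeries ℂ :=
  (∏ p ∈ Finset.univ.filter fun p : Fin n × Fin n => p.1 < p.2,
      brace (form n x (delta n p.1 - delta n p.2))) *
    (∏ p ∈ Finset.univ.filter fun p : Fin n × Fin n => p.1 < p.2,
      brace (form n x (delta n p.1 + delta n p.2))) *
    ∏ i : Fin n, brace (form n x ((2 : ℂ) • delta n i))

/-- `Π_{α ∈ Δ₁⁺} {⟨x,α⟩}` where `Δ₁⁺ = {ε - δ_i} ∪ {ε + δ_i}`. -/
def oddProd (x : V n) : PowerSeries ℂ :=
  (∏ i : Fin n, brace (form n x (eps n - delta n i))) *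
    ∏ i : Fin n, brace (form n x (eps n + delta n i))

theorem brace_coeff (z : ℂ) (k : ℕ) :
    PowerSeries.coeff k (brace z) = ((z / 2) ^ k - (-z / 2) ^ k) / (k.factorial : ℂ) := by
  simp [brace, qpow, exph, sub_div]

theorem X_dvd_brace (z : ℂ) : (PowerSeries.X : PowerSeries ℂ) ∣ brace z := by
  rw [PowerSeries.X_dvd_iff, ← PowerSeries.coeff_zero_eq_constantCoeff_apply, brace_coeff]
  simp

theorem brace_ne_zero {z : ℂ} (hz : z ≠ 0) : brace z ≠ 0 := by
  intro h
  have h1 := brace_coeff z 1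
  rw [h] at h1
  apply hz
  simp only [map_zero, pow_one, Nat.factorial_one, Nat.cast_one, div_one] at h1
  linear_combination -h1

theorem brace_dvd_X {z : ℂ} (hz : z ≠ 0) : brace z ∣ (PowerSeries.X : PowerSeries ℂ) := by
  obtain ⟨u, hu⟩ := X_dvd_brace z
  have hc : PowerSeries.constantCoeff u = z := by
    have h1 := brace_coeff z (0 + 1)
    rw [hu, PowerSeries.coeff_succ_X_mul,
      PowerSeries.coeff_zero_eq_constantCoeff_apply] at h1
    rw [h1]
    simp only [zero_add, pow_one, Nat.factorial_one, Nat.cast_one]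
    ring
  have hunit : IsUnit u := by
    rw [PowerSeries.isUnit_iff_constantCoeff, hc]
    exact hz.isUnit
  rw [hu]
  exact hunit.mul_right_dvd.mpr dvd_rfl

theorem brace_dvd_brace {z : ℂ} (hz : z ≠ 0) (y : ℂ) : brace z ∣ brace y :=
  (brace_dvd_X hz).trans (X_dvd_brace y)

theorem form_add_right (x y z : V n) : form n x (y + z) = form n x y + form n x z := by
  simp only [form, Pi.add_apply, mul_add, Finset.sum_add_distrib]
  ring

theorem form_smul_right (x y : V n) (r : ℂ) : form n x (r • y) = r * form n x y := by
  simp only [form, Pi.smul_apply, smul_eq_mul, mul_sub, Finset.mul_sum]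
  congr 1
  · ring
  · exact Finset.sum_congr rfl fun _ _ => by ring

theorem form_sub_right (x y z : V n) : form n x (y - z) = form n x y - form n x z := by
  rw [sub_eq_add_neg, ← neg_one_smul ℂ z, form_add_right, form_smul_right]
  ring

theorem form_delta (x : V n) (i : Fin n) : form n x (delta n i) = -x i.succ := by
  simp [form, delta, Pi.single_apply, (Fin.succ_ne_zero _).symm]

theorem rho_succ (i : Fin n) : rho n i.succ = ((n - (i : ℕ) : ℤ) : ℂ) := by
  simp [rho, rho0, rho1, eps, delta, Finset.sum_apply, Pi.single_apply]

theorem form_rho_sub_ne_zero {i j : Fin n} (h : i < j) :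
    form n (rho n) (delta n i - delta n j) ≠ 0 := by
  rw [form_sub_right, form_delta, form_delta, rho_succ, rho_succ]
  intro h0
  have h1 := Int.cast_injective (sub_eq_zero.mp h0 |> neg_injective)
  omega

theorem form_rho_add_ne_zero (i j : Fin n) :
    form n (rho n) (delta n i + delta n j) ≠ 0 := by
  rw [form_add_right, form_delta, form_delta, rho_succ, rho_succ, ← neg_add,
    ← Int.cast_add, neg_ne_zero, Int.cast_ne_zero]
  omega

theorem form_rho_two_smul_ne_zero (i : Fin n) :
    form n (rho n) ((2 : ℂ) • delta n i) ≠ 0 := by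
  rw [two_smul]
  exact form_rho_add_ne_zero n i i

theorem evenProd_rho_ne_zero : evenProd n (rho n) ≠ 0 := by
  refine mul_ne_zero (mul_ne_zero ?_ ?_) ?_ <;> refine Finset.prod_ne_zero_iff.mpr ?_
  · exact fun p hp => brace_ne_zero (form_rho_sub_ne_zero n (Finset.mem_filter.mp hp).2)
  · exact fun p _ => brace_ne_zero (form_rho_add_ne_zero n p.1 p.2)
  · exact fun i _ => brace_ne_zero (form_rho_two_smul_ne_zero n i)

theorem evenProd_rho_dvd (x : V n) : evenProd n (rho n) ∣ evenProd n x := by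
  refine mul_dvd_mul (mul_dvd_mul ?_ ?_) ?_ <;> refine Finset.prod_dvd_prod_of_dvd _ _ ?_
  · exact fun p hp => brace_dvd_brace (form_rho_sub_ne_zero n (Finset.mem_filter.mp hp).2) _
  · exact fun p _ => brace_dvd_brace (form_rho_add_ne_zero n p.1 p.2) _
  · exact fun i _ => brace_dvd_brace (form_rho_two_smul_ne_zero n i) _

theorem oddProd_ne_zero {x : V n} (hx : Typical n x) : oddProd n (x + rho n) ≠ 0 :=
  mul_ne_zero (Finset.prod_ne_zero_iff.mpr fun i _ => brace_ne_zero (hx i).1)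
    (Finset.prod_ne_zero_iff.mpr fun i _ => brace_ne_zero (hx i).2)

theorem oddProd_dvd_X_pow {x : V n} (hx : Typical n x) :
    oddProd n (x + rho n) ∣ (PowerSeries.X : PowerSeries ℂ) ^ (2 * n) := by
  have hX : (PowerSeries.X : PowerSeries ℂ) ^ n = ∏ _i : Fin n, PowerSeries.X := by simp
  rw [two_mul, pow_add, hX]
  exact mul_dvd_mul (Finset.prod_dvd_prod_of_dvd _ _ fun i _ => brace_dvd_X (hx i).1)
    (Finset.prod_dvd_prod_of_dvd _ _ fun i _ => brace_dvd_X (hx i).2)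

/-- Lemma (order of the fake quantum dimension, osp(2|2n) case): if `λ = λ_a^c` is
typical, then `Π_{α∈Δ₁⁺} {⟨λ+ρ,α⟩} · Π_{α∈Δ₀⁺} {⟨ρ,α⟩}` is nonzero in `ℂ[[h]]`, and
`h^{2n} · Π_{α∈Δ₀⁺} {⟨λ+ρ,α⟩} = g · Π_{α∈Δ₁⁺} {⟨λ+ρ,α⟩} · Π_{α∈Δ₀⁺} {⟨ρ,α⟩}` for some
`g ∈ ℂ[[h]]`; that is, `d(λ)` lies in `h^{-2n}ℂ[[h]]`. -/
theorem fake_dimension_order (hn : 1 ≤ n)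
    (c : Fin n → ℕ) (a : ℂ) (hty : Typical n (lam n c a)) :
    oddProd n (lam n c a + rho n) * evenProd n (rho n) ≠ 0 ∧
      ∃ g : PowerSeries ℂ,
        (PowerSeries.X : PowerSeries ℂ) ^ (2 * n) * evenProd n (lam n c a + rho n) =
          g * (oddProd n (lam n c a + rho n) * evenProd n (rho n)) := by
  refine ⟨mul_ne_zero (oddProd_ne_zero n hty) (evenProd_rho_ne_zero n), ?_⟩
  obtain ⟨g, hg⟩ := mul_dvd_mul (oddProd_dvd_X_pow n hty) (evenProd_rho_dvd n (lam n c a + rho n))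
  exact ⟨g, hg.trans (mul_comm _ _)⟩

end Osp
end
end

section
/- Proposition (factorization of the typical character, sl(m|n) case): For every λ ∈ V the following identities hold in the group algebra ℂ[V] of the additive group V = ℂ^{m+n} (writing e^v for the basis element of v ∈ V): (Π_{α∈Δ₁⁺} (e^{α/2} − e^{−α/2})) · Σ_{w∈W} ε(w)·e^{w(λ+ρ)} = (Π_{α∈Δ₁⁺} (1 − e^{−α})) · Σ_{w∈W} ε(w)·e^{w(λ+ρ₀)}, and (Π_{α∈Δ₁⁺} (e^{α/2} + e^{−α/2})) · Σ_{w∈W} ε(w)·e^{w(λ+ρ)} = (Π_{α∈Δ₁⁺} (1 + e^{−α})) · Σ_{w∈W} ε(w)·e^{w(λ+ρ₀)}. (Equivalently: by Kac's character formula, the super-character and character of a typical module factor as sch V(λ) = χ'₁·χ₀(λ) and ch V(λ) = χ₁·χ₀(λ), where χ₀(λ) is the character of the even irreducible g₀-module of highest weight λ. A key ingredient is that w(ρ₁) = ρ₁ for every w ∈ W.) -/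
/-!
Proposition (factorization of the typical character, sl(m|n) case).
-/

open scoped BigOperators

noncomputable section

namespace SLmn

variable (m n : ℕ)

/-- The action of `W = S_m × S_n` on `V`, permuting the `ε`-coordinates and the
`δ`-coordinates separately. -/
def act (σ : Equiv.Perm (Fin m)) (τ : Equiv.Perm (Fin n)) (x : V m n) : V m n :=
  fun k =>
    Sum.elim (fun i => x (Fin.castAdd n (σ⁻¹ i))) (fun j => x (Fin.natAdd m (τ⁻¹ j)))
      (finSumFinEquiv.symm k)

/-- The sign `ε(w) = sgn(σ)·sgn(τ)` of `w = (σ,τ) ∈ W`, as a complex number. -/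
def sgn (σ : Equiv.Perm (Fin m)) (τ : Equiv.Perm (Fin n)) : ℂ :=
  (((Equiv.Perm.sign σ : ℤ) * (Equiv.Perm.sign τ : ℤ) : ℤ) : ℂ)

/-- The group algebra `ℂ[V]` of the additive group `V = ℂ^{m+n}`. -/
abbrev GA (m n : ℕ) := AddMonoidAlgebra ℂ (V m n)

/-- The basis element `e^v` of `ℂ[V]`. -/
def E (v : V m n) : GA m n := AddMonoidAlgebra.single v 1

theorem E_add (u v : V m n) : E m n (u + v) = E m n u * E m n v := by
  simp [E, AddMonoidAlgebra.single_mul_single]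

theorem E_zero : E m n 0 = 1 := rfl

theorem E_sum {ι : Type*} (s : Finset ι) (f : ι → V m n) :
    E m n (∑ i ∈ s, f i) = ∏ i ∈ s, E m n (f i) := by
  classical
  induction s using Finset.induction_on with
  | empty => simp [E_zero]
  | insert a s ha ih => rw [Finset.sum_insert ha, Finset.prod_insert ha, E_add, ih]

theorem sum_half_odd_roots :
    ∑ p : Fin m × Fin n, (1 / 2 : ℂ) • (eps m n p.1 - delta m n p.2) = rho1 m n := by
  rw [← Finset.smul_sum, Finset.sum_sub_distrib, Fintype.sum_prod_type, Fintype.sum_prod_type]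
  simp only [Finset.sum_const, Finset.card_univ, Fintype.card_fin, rho1, ← Finset.smul_sum,
    ← Nat.cast_smul_eq_nsmul ℂ]

theorem act_add (σ : Equiv.Perm (Fin m)) (τ : Equiv.Perm (Fin n)) (x y : V m n) :
    act m n σ τ (x + y) = act m n σ τ x + act m n σ τ y := by
  funext k
  refine Fin.addCases (fun i => ?_) (fun j => ?_) k <;> simp [act]

theorem rho1_castAdd (i : Fin m) : rho1 m n (Fin.castAdd n i) = n / 2 := by
  have h (j : Fin n) : Fin.castAdd n i ≠ Fin.natAdd m j := by
    simp only [ne_eq, Fin.ext_iff, Fin.val_castAdd, Fin.val_natAdd]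
    omega
  simp [rho1, eps, delta, Pi.single_apply, h]
  ring

theorem rho1_natAdd (j : Fin n) : rho1 m n (Fin.natAdd m j) = -(m / 2) := by
  have h (i : Fin m) : Fin.natAdd m j ≠ Fin.castAdd n i := by
    simp only [ne_eq, Fin.ext_iff, Fin.val_castAdd, Fin.val_natAdd]
    omega
  simp [rho1, eps, delta, Pi.single_apply, h]
  ring

/-- The vector `ρ₁` is fixed by the Weyl group. -/
theorem act_rho1 (σ : Equiv.Perm (Fin m)) (τ : Equiv.Perm (Fin n)) :
    act m n σ τ (rho1 m n) = rho1 m n := by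
  funext k
  refine Fin.addCases (fun i => ?_) (fun j => ?_) k <;>
    simp [act, rho1_castAdd, rho1_natAdd]

theorem E_rho1_mul_alternating_sum (lamv : V m n) :
    E m n (rho1 m n) * ∑ σ : Equiv.Perm (Fin m), ∑ τ : Equiv.Perm (Fin n),
        sgn m n σ τ • E m n (act m n σ τ (lamv + rho m n)) =
      ∑ σ : Equiv.Perm (Fin m), ∑ τ : Equiv.Perm (Fin n),
        sgn m n σ τ • E m n (act m n σ τ (lamv + rho0 m n)) := by
  simp only [Finset.mul_sum, mul_smul_comm]
  refine Finset.sum_congr rfl fun σ _ => Finset.sum_congr rfl fun τ _ => ?_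
  have h : lamv + rho0 m n = rho1 m n + (lamv + rho m n) := by
    rw [rho]
    abel
  rw [h, act_add m n σ τ (rho1 m n), act_rho1, E_add]

theorem E_half_mul_E_neg (v : V m n) :
    E m n ((1 / 2 : ℂ) • v) * E m n (-v) = E m n (-((1 / 2 : ℂ) • v)) := by
  rw [← E_add]
  congr 1
  module

theorem prod_sub_eq :
    ∏ p : Fin m × Fin n,
        (E m n ((1 / 2 : ℂ) • (eps m n p.1 - delta m n p.2)) -
          E m n (-((1 / 2 : ℂ) • (eps m n p.1 - delta m n p.2)))) =
      (∏ p : Fin m × Fin n, (1 - E m n (-(eps m n p.1 - delta m n p.2)))) *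
        E m n (rho1 m n) := by
  rw [← sum_half_odd_roots, E_sum, ← Finset.prod_mul_distrib]
  refine Finset.prod_congr rfl fun p _ => ?_
  rw [← E_half_mul_E_neg]
  ring

theorem prod_add_eq :
    ∏ p : Fin m × Fin n,
        (E m n ((1 / 2 : ℂ) • (eps m n p.1 - delta m n p.2)) +
          E m n (-((1 / 2 : ℂ) • (eps m n p.1 - delta m n p.2)))) =
      (∏ p : Fin m × Fin n, (1 + E m n (-(eps m n p.1 - delta m n p.2)))) *
        E m n (rho1 m n) := by
  rw [← sum_half_odd_roots, E_sum, ← Finset.prod_mul_distrib]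
  refine Finset.prod_congr rfl fun p _ => ?_
  rw [← E_half_mul_E_neg]
  ring

/-- Proposition (factorization of the typical character, sl(m|n) case): for every
`λ ∈ V`, in `ℂ[V]` one has
`(Π_{α∈Δ₁⁺} (e^{α/2} - e^{-α/2})) · Σ_{w∈W} ε(w)·e^{w(λ+ρ)}
  = (Π_{α∈Δ₁⁺} (1 - e^{-α})) · Σ_{w∈W} ε(w)·e^{w(λ+ρ₀)}`
and
`(Π_{α∈Δ₁⁺} (e^{α/2} + e^{-α/2})) · Σ_{w∈W} ε(w)·e^{w(λ+ρ)}
  = (Π_{α∈Δ₁⁺} (1 + e^{-α})) · Σ_{w∈W} ε(w)·e^{w(λ+ρ₀)}`. -/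
theorem typical_character_factorization (hm : 1 ≤ m) (hn : 1 ≤ n) (hmn : m ≠ n)
    (lamv : V m n) :
    ((∏ p : Fin m × Fin n,
        (E m n ((1 / 2 : ℂ) • (eps m n p.1 - delta m n p.2)) -
          E m n (-((1 / 2 : ℂ) • (eps m n p.1 - delta m n p.2))))) *
      ∑ σ : Equiv.Perm (Fin m), ∑ τ : Equiv.Perm (Fin n),
        sgn m n σ τ • E m n (act m n σ τ (lamv + rho m n)) =
      (∏ p : Fin m × Fin n, (1 - E m n (-(eps m n p.1 - delta m n p.2)))) *
        ∑ σ : Equiv.Perm (Fin m), ∑ τ : Equiv.Perm (Fin n),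
          sgn m n σ τ • E m n (act m n σ τ (lamv + rho0 m n))) ∧
    ((∏ p : Fin m × Fin n,
        (E m n ((1 / 2 : ℂ) • (eps m n p.1 - delta m n p.2)) +
          E m n (-((1 / 2 : ℂ) • (eps m n p.1 - delta m n p.2))))) *
      ∑ σ : Equiv.Perm (Fin m), ∑ τ : Equiv.Perm (Fin n),
        sgn m n σ τ • E m n (act m n σ τ (lamv + rho m n)) =
      (∏ p : Fin m × Fin n, (1 + E m n (-(eps m n p.1 - delta m n p.2)))) *
        ∑ σ : Equiv.Perm (Fin m), ∑ τ : Equiv.Perm (Fin n),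
          sgn m n σ τ • E m n (act m n σ τ (lamv + rho0 m n))) := by
  rw [prod_sub_eq, prod_add_eq, mul_assoc, mul_assoc, E_rho1_mul_alternating_sum]
  exact ⟨rfl, rfl⟩

end SLmn
end
end

section
/- Corollary (vanishing criterion for the Hopf-link pairing): Let c, d ∈ ℕ^{m+n−2} and a, b ∈ ℂ, and suppose λ = λ_a^c is typical; set μ = λ_b^d. Then S'(λ,μ) = 0 in ℂ((h)) if and only if μ is atypical, i.e. if and only if ⟨μ+ρ,α⟩ = 0 for some α ∈ Δ₁⁺. -/
/-!
Corollary (vanishing criterion for the Hopf-link pairing, sl(m|n) case).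
-/

open scoped BigOperators

noncomputable section

namespace SLmn

variable (m n : ℕ)

/-- `N(λ,μ) = Σ_{w ∈ W} ε(w)·exp(⟨w(λ+ρ), μ+ρ⟩·h) ∈ ℂ[[h]]`. -/
def Npair (x y : V m n) : PowerSeries ℂ :=
  ∑ σ : Equiv.Perm (Fin m), ∑ τ : Equiv.Perm (Fin n),
    sgn m n σ τ • exph (form m n (act m n σ τ (x + rho m n)) (y + rho m n))

/-- The inclusion `ℂ[[h]] → ℂ((h))`. -/
def toL : PowerSeries ℂ →+* LaurentSeries ℂ := HahnSeries.ofPowerSeries ℤ ℂ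

/-- The fake quantum dimension
`d(λ) = (Π_{α∈Δ₀⁺} {⟨λ+ρ,α⟩}) / ((Π_{α∈Δ₁⁺} {⟨λ+ρ,α⟩})·(Π_{α∈Δ₀⁺} {⟨ρ,α⟩})) ∈ ℂ((h))`. -/
def dFake (x : V m n) : LaurentSeries ℂ :=
  toL (evenProd m n (x + rho m n)) /
    (toL (oddProd m n (x + rho m n)) * toL (evenProd m n (rho m n)))

/-- `Π_{α ∈ Δ₀⁺} {⟨α, y+ρ⟩}`. -/
def evenProdR (y : V m n) : PowerSeries ℂ :=
  (∏ p ∈ Finset.univ.filter fun p : Fin m × Fin m => p.1 < p.2,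
      brace (form m n (eps m n p.1 - eps m n p.2) (y + rho m n))) *
    ∏ p ∈ Finset.univ.filter fun p : Fin n × Fin n => p.1 < p.2,
      brace (form m n (delta m n p.1 - delta m n p.2) (y + rho m n))

/-- `Π_{α ∈ Δ₁⁺} {⟨α, y+ρ⟩}`. -/
def oddProdR (y : V m n) : PowerSeries ℂ :=
  ∏ p : Fin m × Fin n, brace (form m n (eps m n p.1 - delta m n p.2) (y + rho m n))

/-- The modified Hopf-link pairing
`S'(λ,μ) = (Π_{α∈Δ₁⁺} {⟨α,μ+ρ⟩}) · N(λ,μ) / (Π_{α∈Δ₀⁺} {⟨α,μ+ρ⟩}) ∈ ℂ((h))`. -/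
def Spair (x y : V m n) : LaurentSeries ℂ :=
  toL (oddProdR m n y) * toL (Npair m n x y) / toL (evenProdR m n y)

theorem exph_add (z z' : ℂ) : exph (z + z') = exph z * exph z' := by
  have key (u : ℂ) : exph u = PowerSeries.rescale u (PowerSeries.exp ℂ) := by
    ext j
    simp [exph, PowerSeries.coeff_rescale, PowerSeries.coeff_exp, div_eq_mul_inv]
  rw [key, key, key, PowerSeries.exp_mul_exp_eq_exp_add]

theorem brace_eq_zero_iff (z : ℂ) : brace z = 0 ↔ z = 0 := by
  refine ⟨fun h => ?_, fun h => by simp [h, brace]⟩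
  have h1 := congrArg (PowerSeries.coeff 1) h
  simp only [brace, qpow, exph, map_sub, PowerSeries.coeff_mk, map_zero] at h1
  simp only [pow_one, Nat.factorial_one, Nat.cast_one, div_one] at h1
  linear_combination h1

/-- A linear combination of exponentials in which some exponent with nonzero coefficient
occurs only once does not vanish. -/
theorem sum_smul_exph_ne_zero {ι : Type*} [Fintype ι] (c z : ι → ℂ) (i₀ : ι) (hc : c i₀ ≠ 0)
    (hz : ∀ i, z i = z i₀ → i = i₀) : ∑ i, c i • exph (z i) ≠ 0 := by
  classical
  intro h
  have hpow (j : ℕ) : ∑ i, c i * z i ^ j = 0 := by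
    have hj := congrArg (PowerSeries.coeff j) h
    simp only [map_sum, PowerSeries.coeff_smul, exph, PowerSeries.coeff_mk, smul_eq_mul,
      map_zero, mul_div_assoc', ← Finset.sum_div] at hj
    exact (div_eq_zero_iff.mp hj).resolve_right (by exact_mod_cast j.factorial_ne_zero)
  have heval (P : Polynomial ℂ) : ∑ i, c i * P.eval (z i) = 0 := by
    simp only [Polynomial.eval_eq_sum_range, Finset.mul_sum]
    rw [Finset.sum_comm]
    refine Finset.sum_eq_zero fun j _ => ?_
    simp only [mul_left_comm (c _), ← Finset.mul_sum, hpow, mul_zero]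
  have hP := heval (∏ i ∈ Finset.univ.erase i₀, (Polynomial.X - Polynomial.C (z i)))
  simp only [Polynomial.eval_prod, Polynomial.eval_sub, Polynomial.eval_X,
    Polynomial.eval_C] at hP
  rw [Finset.sum_eq_single i₀] at hP
  · refine mul_ne_zero hc (Finset.prod_ne_zero_iff.mpr fun i hi => ?_) hP
    exact fun h0 => Finset.ne_of_mem_erase hi (hz i (sub_eq_zero.mp h0).symm)
  · intro i _ hi
    rw [Finset.prod_eq_zero (i := i) (by simp [hi]) (sub_self _), mul_zero]
  · simp

/-- The equality case of the rearrangement inequality for strictly decreasing sequences. -/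
theorem perm_eq_one_of_sum_mul_eq {k : ℕ} {p q : Fin k → ℝ} (hp : StrictAnti p)
    (hq : StrictAnti q) (σ : Equiv.Perm (Fin k))
    (h : ∑ i, p (σ i) * q i = ∑ i, p i * q i) : σ = 1 := by
  have hpq : Monovary p q := hp.antitone.monovary hq.antitone
  have hv := hpq.sum_comp_perm_mul_eq_sum_mul_iff.mp h
  have hmono : StrictMono σ := by
    intro i j hij
    exact lt_of_le_of_ne (hp.le_iff_ge.mp (hv (hq hij))) (σ.injective.ne hij.ne)
  ext i
  exact congrArg Fin.val (congrFun (Subsingleton.elim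
    (hmono.orderIsoOfSurjective σ σ.surjective) (OrderIso.refl _) |> congrArg DFunLike.coe) i)

/-- The alternating exponential sum of two strictly decreasing real sequences, each shifted by
a complex constant, is nonzero. -/
theorem sum_sign_smul_exph_ne_zero {k : ℕ} {p q : Fin k → ℝ} (hp : StrictAnti p)
    (hq : StrictAnti q) (s t : ℂ) {e : ℂ} (he : e ≠ 0) :
    ∑ σ : Equiv.Perm (Fin k), ((Equiv.Perm.sign σ : ℤ) : ℂ) •
      exph (e * ∑ i, (s + p (σ⁻¹ i)) * (t + q i)) ≠ 0 := by
  refine sum_smul_exph_ne_zero _ _ 1 (by simp) fun σ h => ?_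
  have h := mul_left_cancel₀ he h
  have hexp (τ : Equiv.Perm (Fin k)) : ∑ i, (s + p (τ i)) * (t + q i) =
      (∑ i, s * (t + q i)) + t * (∑ i, (p i : ℂ)) + ((∑ i, p (τ i) * q i : ℝ) : ℂ) := by
    rw [← Equiv.sum_comp τ (fun i => (p i : ℂ))]
    push_cast
    rw [Finset.mul_sum, ← Finset.sum_add_distrib, ← Finset.sum_add_distrib]
    exact Finset.sum_congr rfl fun i _ => by ring
  rw [hexp, hexp] at h
  have h' := Complex.ofReal_injective (add_left_cancel h)
  exact inv_eq_one.mp (perm_eq_one_of_sum_mul_eq hp hq σ⁻¹ (by simpa using h'))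

section Coordinates

variable (c : Fin (m + n - 2) → ℕ) (a : ℂ)

theorem eps_castAdd (i k : Fin m) :
    eps m n i (Fin.castAdd n k) = if i = k then 1 else 0 := by
  simp [eps, Pi.single_apply, eq_comm]

theorem eps_natAdd (i : Fin m) (k : Fin n) : eps m n i (Fin.natAdd m k) = 0 := by
  have : Fin.natAdd m k ≠ Fin.castAdd n i := fun h => by
    have := congrArg Fin.val h
    simp at this
    omega
  simp [eps, this]

theorem delta_natAdd (j k : Fin n) :
    delta m n j (Fin.natAdd m k) = if j = k then 1 else 0 := by
  simp [delta, Pi.single_apply, eq_comm]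

theorem delta_castAdd (j : Fin n) (k : Fin m) : delta m n j (Fin.castAdd n k) = 0 := by
  have : Fin.castAdd n k ≠ Fin.natAdd m j := fun h => by
    have := congrArg Fin.val h
    simp at this
    omega
  simp [delta, this]

theorem w_castAdd (k : ℕ) (i : Fin m) :
    w m n k (Fin.castAdd n i) = if k ≤ m ∧ (i : ℕ) < k then 1 else 0 := by
  unfold w
  split_ifs with h1 h2 h2 <;>
    simp_all [eps_castAdd, delta_castAdd, Finset.sum_apply]

theorem w_natAdd (k : ℕ) (j : Fin n) :
    w m n k (Fin.natAdd m j) = if m < k ∧ k - m ≤ (j : ℕ) then -1 else 0 := by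
  unfold w
  split_ifs with h1 h2 h2 <;>
    simp_all [eps_natAdd, delta_natAdd, Finset.sum_apply] <;> omega

/-- Up to a common shift, the `ε`-coordinates of `λ_a^c + ρ` are real and strictly decreasing. -/
theorem exists_strictAnti_lam_add_rho_castAdd : ∃ (s : ℂ) (p : Fin m → ℝ), StrictAnti p ∧
    ∀ i, (lam m n c a + rho m n) (Fin.castAdd n i) = s + p i := by
  refine ⟨a + (m - n - 1) / 2, fun i => (∑ k, (c k : ℝ) *
    if wIdx m k ≤ m ∧ (i : ℕ) < wIdx m k then 1 else 0) - (i : ℕ), fun i j hij => ?_,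
    fun i => ?_⟩
  · have hij' : ((i : ℕ) : ℝ) < (j : ℕ) := by exact_mod_cast hij
    refine (sub_lt_sub_left hij' _).trans_le (sub_le_sub_right (Finset.sum_le_sum fun k _ => ?_) _)
    refine mul_le_mul_of_nonneg_left ?_ (Nat.cast_nonneg _)
    have : (i : ℕ) < j := hij
    split_ifs <;> first | omega | norm_num
  · simp [lam, rho, rho0, rho1, Finset.sum_apply, w_castAdd, eps_castAdd, delta_castAdd,
      apply_ite Complex.ofReal]
    ring

/-- Up to a common shift, the `δ`-coordinates of `λ_a^c + ρ` are real and strictly decreasing. -/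
theorem exists_strictAnti_lam_add_rho_natAdd : ∃ (s : ℂ) (p : Fin n → ℝ), StrictAnti p ∧
    ∀ j, (lam m n c a + rho m n) (Fin.natAdd m j) = s + p j := by
  refine ⟨(n + m - 1) / 2, fun j => (∑ k, (c k : ℝ) *
    if m < wIdx m k ∧ wIdx m k - m ≤ (j : ℕ) then -1 else 0) - (j : ℕ), fun i j hij => ?_,
    fun j => ?_⟩
  · have hij' : ((i : ℕ) : ℝ) < (j : ℕ) := by exact_mod_cast hij
    refine (sub_lt_sub_left hij' _).trans_le (sub_le_sub_right (Finset.sum_le_sum fun k _ => ?_) _)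
    refine mul_le_mul_of_nonneg_left ?_ (Nat.cast_nonneg _)
    have : (i : ℕ) < j := hij
    split_ifs <;> first | omega | norm_num
  · simp [lam, rho, rho0, rho1, Finset.sum_apply, w_natAdd, eps_natAdd, delta_natAdd,
      apply_ite Complex.ofReal]
    ring

end Coordinates

theorem form_comm (x y : V m n) : form m n x y = form m n y x := by
  simp only [form, mul_comm]

theorem form_eps (i : Fin m) (x : V m n) : form m n (eps m n i) x = x (Fin.castAdd n i) := by
  simp [form, eps_castAdd, eps_natAdd]

theorem form_delta (j : Fin n) (x : V m n) :
    form m n (delta m n j) x = -x (Fin.natAdd m j) := by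
  simp [form, delta_castAdd, delta_natAdd]

theorem form_sub_left (x y z : V m n) :
    form m n (x - y) z = form m n x z - form m n y z := by
  simp only [form, Pi.sub_apply, sub_mul, Finset.sum_sub_distrib]
  ring

theorem Npair_lam_ne_zero (c d : Fin (m + n - 2) → ℕ) (a b : ℂ) :
    Npair m n (lam m n c a) (lam m n d b) ≠ 0 := by
  obtain ⟨s, p, hp, hx⟩ := exists_strictAnti_lam_add_rho_castAdd m n c a
  obtain ⟨s', p', hp', hx'⟩ := exists_strictAnti_lam_add_rho_natAdd m n c a
  obtain ⟨t, q, hq, hy⟩ := exists_strictAnti_lam_add_rho_castAdd m n d b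
  obtain ⟨t', q', hq', hy'⟩ := exists_strictAnti_lam_add_rho_natAdd m n d b
  convert mul_ne_zero (sum_sign_smul_exph_ne_zero hp hq s t one_ne_zero)
    (sum_sign_smul_exph_ne_zero hp' hq' s' t' (neg_ne_zero.mpr one_ne_zero)) using 1
  rw [Finset.sum_mul_sum]
  refine Finset.sum_congr rfl fun σ _ => Finset.sum_congr rfl fun τ _ => ?_
  rw [smul_mul_smul_comm, ← exph_add]
  congr 1
  · simp [sgn]
  · congr 1
    simp [form, act, hx, hx', hy, hy', sub_eq_add_neg]

theorem evenProdR_lam_ne_zero (d : Fin (m + n - 2) → ℕ) (b : ℂ) :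
    evenProdR m n (lam m n d b) ≠ 0 := by
  obtain ⟨t, q, hq, hy⟩ := exists_strictAnti_lam_add_rho_castAdd m n d b
  obtain ⟨t', q', hq', hy'⟩ := exists_strictAnti_lam_add_rho_natAdd m n d b
  refine mul_ne_zero (Finset.prod_ne_zero_iff.mpr fun x hx => ?_)
    (Finset.prod_ne_zero_iff.mpr fun x hx => ?_)
  · have hlt : x.1 < x.2 := (Finset.mem_filter.mp hx).2
    rw [Ne, brace_eq_zero_iff, form_sub_left, form_eps, form_eps, hy, hy, add_sub_add_left_eq_sub,
      sub_eq_zero, Complex.ofReal_inj]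
    exact (hq hlt).ne'
  · have hlt : x.1 < x.2 := (Finset.mem_filter.mp hx).2
    rw [Ne, brace_eq_zero_iff, form_sub_left, form_delta, form_delta, hy', hy', sub_eq_zero,
      neg_inj, add_right_inj, Complex.ofReal_inj]
    exact (hq' hlt).ne'

theorem oddProdR_eq_zero_iff (y : V m n) : oddProdR m n y = 0 ↔
    ∃ (i : Fin m) (j : Fin n), form m n (y + rho m n) (eps m n i - delta m n j) = 0 := by
  simp only [oddProdR, Finset.prod_eq_zero_iff, brace_eq_zero_iff, Finset.mem_univ, true_and,
    Prod.exists, form_comm m n (y + rho m n)]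

theorem toL_eq_zero_iff (f : PowerSeries ℂ) : toL f = 0 ↔ f = 0 :=
  map_eq_zero_iff _ HahnSeries.ofPowerSeries_injective

/-- Corollary (vanishing criterion for the Hopf-link pairing): if `λ = λ_a^c` is
typical and `μ = λ_b^d`, then `S'(λ,μ) = 0` in `ℂ((h))` if and only if `μ` is
atypical, i.e. `⟨μ+ρ,α⟩ = 0` for some odd positive root `α = ε_i - δ_j`. -/
theorem Spair_eq_zero_iff_atypical (hm : 1 ≤ m) (hn : 1 ≤ n) (hmn : m ≠ n)
    (c d : Fin (m + n - 2) → ℕ) (a b : ℂ) (hlam : Typical m n (lam m n c a)) :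
    Spair m n (lam m n c a) (lam m n d b) = 0 ↔
      ∃ (i : Fin m) (j : Fin n),
        form m n (lam m n d b + rho m n) (eps m n i - delta m n j) = 0 := by
  rw [Spair, div_eq_zero_iff, mul_eq_zero]
  simp only [toL_eq_zero_iff, evenProdR_lam_ne_zero, Npair_lam_ne_zero, or_false,
    oddProdR_eq_zero_iff]

end SLmn
end
end

section
/- Proposition (factorization of the typical character, osp(2|2n) case): For every λ ∈ V the following identities hold in the group algebra ℂ[V] of the additive group V = ℂ^{1+n} (writing e^v for the basis element of v ∈ V): (Π_{α∈Δ₁⁺} (e^{α/2} − e^{−α/2})) · Σ_{w∈W} ε(w)·e^{w(λ+ρ)} = (Π_{α∈Δ₁⁺} (1 − e^{−α})) · Σ_{w∈W} ε(w)·e^{w(λ+ρ₀)}, and (Π_{α∈Δ₁⁺} (e^{α/2} + e^{−α/2})) · Σ_{w∈W} ε(w)·e^{w(λ+ρ)} = (Π_{α∈Δ₁⁺} (1 + e^{−α})) · Σ_{w∈W} ε(w)·e^{w(λ+ρ₀)}. (A key ingredient is that w(ρ₁) = ρ₁ for every w ∈ W.) -/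
/-!
Proposition (factorization of the typical character, osp(2|2n) case).
-/

open scoped BigOperators

noncomputable section

namespace Osp

variable (n : ℕ)

/-- The action on `V` of the element of the Weyl group `W = (ℤ/2)^n ⋊ S_n` of `sp(2n)`
given by signs `s : Fin n → Bool` (`true` = `+1`, `false` = `-1`) and a permutation
`σ`: it fixes `ε`, permutes the `δ`-coordinates and changes their signs. -/
def act (s : Fin n → Bool) (σ : Equiv.Perm (Fin n)) (x : V n) : V n :=
  fun k =>
    Fin.cases (x 0) (fun j => (if s j then (1 : ℂ) else -1) * x (σ⁻¹ j).succ) k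

/-- The sign `ε(w) = det(w)` of the Weyl group element `w = (s,σ)`. -/
def sgn (s : Fin n → Bool) (σ : Equiv.Perm (Fin n)) : ℂ :=
  ((Equiv.Perm.sign σ : ℤ) : ℂ) * ∏ j : Fin n, (if s j then (1 : ℂ) else -1)

/-- The group algebra `ℂ[V]` of the additive group `V = ℂ^{1+n}`. -/
abbrev GA (n : ℕ) := AddMonoidAlgebra ℂ (V n)

/-- The basis element `e^v` of `ℂ[V]`. -/
def E (v : V n) : GA n := AddMonoidAlgebra.single v 1

lemma E_mul (u v : V n) : E n u * E n v = E n (u + v) := by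
  simp [E, AddMonoidAlgebra.single_mul_single]

lemma E_zero : E n 0 = 1 := rfl

lemma E_pow (v : V n) (k : ℕ) : E n v ^ k = E n ((k : ℂ) • v) := by
  induction k with
  | zero => simp [E_zero]
  | succ k ih => rw [pow_succ, ih, E_mul, Nat.cast_succ, add_smul, one_smul]

lemma E_half_mul (a : V n) : E n ((1 / 2 : ℂ) • a) * E n (-a) = E n (-((1 / 2 : ℂ) • a)) := by
  rw [E_mul]
  congr 1
  module

lemma E_half_sub (a : V n) :
    E n ((1 / 2 : ℂ) • a) - E n (-((1 / 2 : ℂ) • a)) =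
      E n ((1 / 2 : ℂ) • a) * (1 - E n (-a)) := by
  rw [mul_sub, mul_one, E_half_mul]

lemma E_half_add (a : V n) :
    E n ((1 / 2 : ℂ) • a) + E n (-((1 / 2 : ℂ) • a)) =
      E n ((1 / 2 : ℂ) • a) * (1 + E n (-a)) := by
  rw [mul_add, mul_one, E_half_mul]

/-- The half-sum of the odd positive roots is `ρ₁`, written multiplicatively. -/
lemma prod_E_half_roots :
    (∏ i : Fin n, E n ((1 / 2 : ℂ) • (eps n - delta n i))) *
      (∏ i : Fin n, E n ((1 / 2 : ℂ) • (eps n + delta n i))) = E n (rho1 n) := by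
  have h (i : Fin n) : E n ((1 / 2 : ℂ) • (eps n - delta n i)) *
      E n ((1 / 2 : ℂ) • (eps n + delta n i)) = E n (eps n) := by
    rw [E_mul]
    congr 1
    module
  rw [← Finset.prod_mul_distrib, Finset.prod_congr rfl fun i _ => h i, Finset.prod_const,
    Finset.card_univ, Fintype.card_fin, E_pow, rho1]

/-- The Weyl group fixes `ρ₁`. -/
lemma rho1_add_act (s : Fin n → Bool) (σ : Equiv.Perm (Fin n)) (x : V n) :
    rho1 n + act n s σ (x + rho n) = act n s σ (x + rho0 n) := by
  ext k
  refine Fin.cases ?_ (fun j => ?_) k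
  · simp only [act, rho, rho1, eps, Pi.add_apply, Pi.sub_apply, Fin.cases_zero]
    ring
  · simp [act, rho, rho1, eps]

lemma E_rho1_mul_alternating_sum (x : V n) :
    E n (rho1 n) * ∑ s : Fin n → Bool, ∑ σ : Equiv.Perm (Fin n),
        sgn n s σ • E n (act n s σ (x + rho n)) =
      ∑ s : Fin n → Bool, ∑ σ : Equiv.Perm (Fin n),
        sgn n s σ • E n (act n s σ (x + rho0 n)) := by
  simp only [Finset.mul_sum, mul_smul_comm, E_mul, rho1_add_act]

/-- Proposition (factorization of the typical character, osp(2|2n) case): for every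
`λ ∈ V`, in `ℂ[V]` one has
`(Π_{α∈Δ₁⁺} (e^{α/2} - e^{-α/2})) · Σ_{w∈W} ε(w)·e^{w(λ+ρ)}
  = (Π_{α∈Δ₁⁺} (1 - e^{-α})) · Σ_{w∈W} ε(w)·e^{w(λ+ρ₀)}`
and
`(Π_{α∈Δ₁⁺} (e^{α/2} + e^{-α/2})) · Σ_{w∈W} ε(w)·e^{w(λ+ρ)}
  = (Π_{α∈Δ₁⁺} (1 + e^{-α})) · Σ_{w∈W} ε(w)·e^{w(λ+ρ₀)}`,
where `Δ₁⁺ = {ε - δ_i} ∪ {ε + δ_i}`. -/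
theorem typical_character_factorization (hn : 1 ≤ n) (lamv : V n) :
    ((∏ i : Fin n,
        (E n ((1 / 2 : ℂ) • (eps n - delta n i)) -
          E n (-((1 / 2 : ℂ) • (eps n - delta n i))))) *
      (∏ i : Fin n,
        (E n ((1 / 2 : ℂ) • (eps n + delta n i)) -
          E n (-((1 / 2 : ℂ) • (eps n + delta n i))))) *
      ∑ s : Fin n → Bool, ∑ σ : Equiv.Perm (Fin n),
        sgn n s σ • E n (act n s σ (lamv + rho n)) =
      (∏ i : Fin n, (1 - E n (-(eps n - delta n i)))) *
        (∏ i : Fin n, (1 - E n (-(eps n + delta n i)))) *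
        ∑ s : Fin n → Bool, ∑ σ : Equiv.Perm (Fin n),
          sgn n s σ • E n (act n s σ (lamv + rho0 n))) ∧
    ((∏ i : Fin n,
        (E n ((1 / 2 : ℂ) • (eps n - delta n i)) +
          E n (-((1 / 2 : ℂ) • (eps n - delta n i))))) *
      (∏ i : Fin n,
        (E n ((1 / 2 : ℂ) • (eps n + delta n i)) +
          E n (-((1 / 2 : ℂ) • (eps n + delta n i))))) *
      ∑ s : Fin n → Bool, ∑ σ : Equiv.Perm (Fin n),
        sgn n s σ • E n (act n s σ (lamv + rho n)) =
      (∏ i : Fin n, (1 + E n (-(eps n - delta n i)))) *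
        (∏ i : Fin n, (1 + E n (-(eps n + delta n i)))) *
        ∑ s : Fin n → Bool, ∑ σ : Equiv.Perm (Fin n),
          sgn n s σ • E n (act n s σ (lamv + rho0 n))) := by
  constructor
  · simp only [E_half_sub, Finset.prod_mul_distrib]
    rw [← E_rho1_mul_alternating_sum, ← prod_E_half_roots]
    ring
  · simp only [E_half_add, Finset.prod_mul_distrib]
    rw [← E_rho1_mul_alternating_sum, ← prod_E_half_roots]
    ring

end Osp
end
end

section
/- Lemma (nonvanishing of the evaluated even character, osp(2|2n) case): For all c, d ∈ ℕ^n and all a, b ∈ ℂ, setting λ = λ_a^c and μ = λ_b^d, the formal power series N(λ,μ) := Σ_{w∈W} ε(w)·exp(⟨w(λ+ρ), μ+ρ⟩·h) is a nonzero element of ℂ[[h]]. (This is the claim φ_{μ+ρ}(χ₀(λ)) ≠ 0 used in the proof of the vanishing criterion for S'.) -/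
/-!
Lemma (nonvanishing of the evaluated even character, osp(2|2n) case).
-/

open scoped BigOperators

noncomputable section

namespace Osp

variable (n : ℕ)

/-- `N(λ,μ) = Σ_{w ∈ W} ε(w)·exp(⟨w(λ+ρ), μ+ρ⟩·h) ∈ ℂ[[h]]`. -/
def Npair (x y : V n) : PowerSeries ℂ :=
  ∑ s : Fin n → Bool, ∑ σ : Equiv.Perm (Fin n),
    sgn n s σ • exph (form n (act n s σ (x + rho n)) (y + rho n))

/-- The inclusion `ℂ[[h]] → ℂ((h))`. -/
def toL : PowerSeries ℂ →+* LaurentSeries ℂ := HahnSeries.ofPowerSeries ℤ ℂ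

/-- The fake quantum dimension
`d(λ) = (Π_{α∈Δ₀⁺} {⟨λ+ρ,α⟩}) / ((Π_{α∈Δ₁⁺} {⟨λ+ρ,α⟩})·(Π_{α∈Δ₀⁺} {⟨ρ,α⟩})) ∈ ℂ((h))`. -/
def dFake (x : V n) : LaurentSeries ℂ :=
  toL (evenProd n (x + rho n)) /
    (toL (oddProd n (x + rho n)) * toL (evenProd n (rho n)))

/-- `Π_{α ∈ Δ₀⁺} {⟨α, y+ρ⟩}`. -/
def evenProdR (y : V n) : PowerSeries ℂ :=
  (∏ p ∈ Finset.univ.filter fun p : Fin n × Fin n => p.1 < p.2,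
      brace (form n (delta n p.1 - delta n p.2) (y + rho n))) *
    (∏ p ∈ Finset.univ.filter fun p : Fin n × Fin n => p.1 < p.2,
      brace (form n (delta n p.1 + delta n p.2) (y + rho n))) *
    ∏ i : Fin n, brace (form n ((2 : ℂ) • delta n i) (y + rho n))

/-- `Π_{α ∈ Δ₁⁺} {⟨α, y+ρ⟩}`. -/
def oddProdR (y : V n) : PowerSeries ℂ :=
  (∏ i : Fin n, brace (form n (eps n - delta n i) (y + rho n))) *
    ∏ i : Fin n, brace (form n (eps n + delta n i) (y + rho n))

/-- The modified Hopf-link pairing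
`S'(λ,μ) = (Π_{α∈Δ₁⁺} {⟨α,μ+ρ⟩}) · N(λ,μ) / (Π_{α∈Δ₀⁺} {⟨α,μ+ρ⟩}) ∈ ℂ((h))`. -/
def Spair (x y : V n) : LaurentSeries ℂ :=
  toL (oddProdR n y) * toL (Npair n x y) / toL (evenProdR n y)

/-- The `δ_j`-coordinate of `λ_a^c + ρ`, as an integer. -/
def deltaCoord (c : Fin n → ℕ) (j : Fin n) : ℤ :=
  ∑ k ∈ Finset.univ.filter fun k : Fin n => j ≤ k, (c k : ℤ) + ((n : ℤ) - (j : ℕ))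

theorem deltaCoord_pos (c : Fin n → ℕ) (j : Fin n) : 0 < deltaCoord n c j := by
  have h : (0 : ℤ) ≤ ∑ k ∈ Finset.univ.filter fun k : Fin n => j ≤ k, (c k : ℤ) :=
    Finset.sum_nonneg fun k _ => Int.natCast_nonneg _
  have hj := j.isLt
  unfold deltaCoord
  lia

theorem deltaCoord_strictAnti (c : Fin n → ℕ) : StrictAnti (deltaCoord n c) := by
  intro i j hij
  have h : ∑ k ∈ Finset.univ.filter fun k : Fin n => j ≤ k, (c k : ℤ) ≤
      ∑ k ∈ Finset.univ.filter fun k : Fin n => i ≤ k, (c k : ℤ) := by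
    refine Finset.sum_le_sum_of_subset_of_nonneg (fun k hk => ?_)
      fun k _ _ => Int.natCast_nonneg _
    simp only [Finset.mem_filter, Finset.mem_univ, true_and] at hk ⊢
    exact hij.le.trans hk
  have hij' : (i : ℕ) < j := hij
  unfold deltaCoord
  lia

theorem delta_apply_succ (i j : Fin n) : delta n i j.succ = if j = i then 1 else 0 := by
  simp [delta, Pi.single_apply]

theorem lam_add_rho_apply_succ (c : Fin n → ℕ) (a : ℂ) (j : Fin n) :
    (lam n c a + rho n) j.succ = (deltaCoord n c j : ℂ) := by
  simp [lam, rho, rho0, rho1, w, eps, delta_apply_succ, Finset.sum_apply, deltaCoord,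
    Finset.sum_filter, ite_apply]
  refine Finset.sum_congr rfl fun k _ => ?_
  rw [Finset.sum_eq_single j] <;> simp +contextual [eq_comm]

theorem form_act (s : Fin n → Bool) (σ : Equiv.Perm (Fin n)) {x y : V n} {l m : Fin n → ℤ}
    (hx : ∀ j, x j.succ = l j) (hy : ∀ j, y j.succ = m j) :
    form n (act n s σ x) y =
      x 0 * y 0 - ((∑ j, (if s j then 1 else -1) * l (σ⁻¹ j) * m j : ℤ) : ℂ) := by
  simp [form, act, hx, hy]

/-- A monotone permutation of a finite chain is trivial. -/
theorem perm_eq_one_of_strictMono {n : ℕ} {σ : Equiv.Perm (Fin n)} (h : StrictMono σ) : σ = 1 := by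
  ext j
  have := Subsingleton.elim (h.orderIsoOfSurjective σ σ.surjective) (OrderIso.refl (Fin n))
  simpa using congrArg (fun e : Fin n ≃o Fin n => ((e j : Fin n) : ℕ)) this

/-- For two regular dominant weights `l`, `m`, the pairing `⟨w l, m⟩` attains its maximum over the
Weyl group only at the identity. -/
theorem sum_signed_perm_lt {n : ℕ} {l m : Fin n → ℤ} (hl : StrictAnti l) (hm : StrictAnti m)
    (hl0 : ∀ j, 0 < l j) (hm0 : ∀ j, 0 < m j) {s : Fin n → Bool} {σ : Equiv.Perm (Fin n)}
    (h : (s, σ) ≠ (fun _ => true, 1)) :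
    ∑ j, (if s j then 1 else -1) * l (σ⁻¹ j) * m j < ∑ j, l j * m j := by
  have hmono : Monovary l m := hl.antitone.monovary hm.antitone
  have hterm : ∀ j, (if s j then 1 else -1) * l (σ⁻¹ j) * m j ≤ l (σ⁻¹ j) * m j := by
    intro j
    have := mul_pos (hl0 (σ⁻¹ j)) (hm0 j)
    split_ifs <;> linarith
  have hperm : ∑ j, l (σ⁻¹ j) * m j ≤ ∑ j, l j * m j := hmono.sum_comp_perm_mul_le_sum_mul
  by_cases hs : ∃ j, s j = false
  · obtain ⟨j, hj⟩ := hs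
    refine lt_of_lt_of_le (Finset.sum_lt_sum (fun i _ => hterm i) ⟨j, Finset.mem_univ j, ?_⟩) hperm
    have := mul_pos (hl0 (σ⁻¹ j)) (hm0 j)
    simp only [hj, Bool.false_eq_true, if_false]
    linarith
  · refine lt_of_le_of_lt (Finset.sum_le_sum fun i _ => hterm i) (lt_of_le_of_ne hperm fun heq => h ?_)
    have hs' : s = fun _ => true := by
      funext j
      simpa using not_exists.mp hs j
    have hcomp : Monovary (l ∘ (σ⁻¹ : Equiv.Perm (Fin n))) m :=
      hmono.sum_comp_perm_mul_eq_sum_mul_iff.mp heq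
    have hσ : StrictMono (σ⁻¹ : Equiv.Perm (Fin n)) := by
      refine Monotone.strictMono_of_injective (fun i j hij => ?_) (σ⁻¹).injective
      rcases hij.eq_or_lt with rfl | hij
      · exact le_rfl
      · exact hl.le_iff_ge.mp (hcomp (hm hij))
    rw [hs', inv_eq_one.mp (perm_eq_one_of_strictMono hσ)]

theorem sum_smul_exph_ne_zero {ι : Type*} [Fintype ι] (r z : ι → ℂ) (i₀ : ι) (hr : r i₀ ≠ 0)
    (hz : ∀ i, i ≠ i₀ → z i ≠ z i₀) : ∑ i, r i • exph (z i) ≠ 0 := by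
  classical
  intro h
  have hpow : ∀ k : ℕ, ∑ i, r i * z i ^ k = 0 := by
    intro k
    have hk := congrArg (PowerSeries.coeff k) h
    simp only [map_sum, exph, PowerSeries.coeff_smul, PowerSeries.coeff_mk, map_zero,
      ← mul_div_assoc, ← Finset.sum_div, smul_eq_mul] at hk
    exact (div_eq_zero_iff.mp hk).resolve_right (Nat.cast_ne_zero.mpr k.factorial_ne_zero)
  have hpoly : ∀ p : Polynomial ℂ, ∑ i, r i * p.eval (z i) = 0 := by
    intro p
    simp only [Polynomial.eval_eq_sum_range, Finset.mul_sum]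
    rw [Finset.sum_comm]
    refine Finset.sum_eq_zero fun k _ => ?_
    simp_rw [mul_left_comm (r _), ← Finset.mul_sum]
    rw [hpow, mul_zero]
  have hP := hpoly (∏ i ∈ Finset.univ.erase i₀, (Polynomial.X - Polynomial.C (z i)))
  rw [Finset.sum_eq_single i₀] at hP
  · rw [Polynomial.eval_prod] at hP
    refine mul_ne_zero hr (Finset.prod_ne_zero_iff.mpr fun i hi => ?_) hP
    simpa [sub_eq_zero] using (hz i (Finset.ne_of_mem_erase hi)).symm
  · intro i _ hi
    rw [Polynomial.eval_prod, Finset.prod_eq_zero (Finset.mem_erase.mpr ⟨hi, Finset.mem_univ i⟩)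
      (by simp), mul_zero]
  · simp

/-- Lemma (nonvanishing of the evaluated even character, osp(2|2n) case): for all
`c, d ∈ ℕ^n` and `a, b ∈ ℂ`, with `λ = λ_a^c` and `μ = λ_b^d`, the power series
`N(λ,μ) = Σ_{w∈W} ε(w)·exp(⟨w(λ+ρ), μ+ρ⟩·h)` is nonzero in `ℂ[[h]]`. -/
theorem Npair_ne_zero (hn : 1 ≤ n) (c d : Fin n → ℕ) (a b : ℂ) :
    Npair n (lam n c a) (lam n d b) ≠ 0 := by
  rw [Npair, ← Fintype.sum_prod_type' (f := fun s σ =>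
    sgn n s σ • exph (form n (act n s σ (lam n c a + rho n)) (lam n d b + rho n)))]
  refine sum_smul_exph_ne_zero (fun p : (Fin n → Bool) × Equiv.Perm (Fin n) => sgn n p.1 p.2)
    (fun p => form n (act n p.1 p.2 (lam n c a + rho n)) (lam n d b + rho n))
    (fun _ => true, 1) (by simp [sgn]) ?_
  rintro ⟨s, σ⟩ hp heq
  have hform := fun s σ => form_act n s σ (lam_add_rho_apply_succ n c a)
    (lam_add_rho_apply_succ n d b)
  simp only [hform, sub_right_inj, Int.cast_inj] at heq
  refine (sum_signed_perm_lt (deltaCoord_strictAnti n c) (deltaCoord_strictAnti n d)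
    (deltaCoord_pos n c) (deltaCoord_pos n d) hp).ne (heq.trans ?_)
  simp

end Osp
end
end
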